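/- Let a, b ≥ 1. Let S be an abelian subgroup of the group of invertible 2^{a+b} × 2^{a+b} complex matrices whose elements are all signed (a+b)-qubit Pauli strings, with |S| = 2^{a+b} and −Id ∉ S; let T be an abelian subgroup of the group of invertible 2^a × 2^a complex matrices whose elements are all signed a-qubit Pauli strings, with |T| = 2^a and −Id ∉ T. Set Π_S = 2^{−(a+b)} Σ_{s∈S} s and Π_T = 2^{−a} Σ_{t∈T} t, and let M = Tr_A((Π_T ⊗ Id_{2^b}) · Π_S) be the partial trace over the first a qubits. If M ≠ 0, then there exist an abelian group U of signed b-qubit Pauli strings with |U| = 2^b and −Id ∉ U, and a real constant c > 0, such that M = c · Σ_{u∈U} u. (In other words, the contraction of a stabilizer state with a stabilizer state is, when nonzero, again proportional to a stabilizer-state projector.) -/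

import Mathlib

/-- The four single-qubit Pauli matrices: `I`, `X`, `Y`, `Z`. -/
noncomputable def pauliMat : Fin 4 → Matrix (Fin 2) (Fin 2) ℂ :=
  ![1, !![0, 1; 1, 0], !![0, -Complex.I; Complex.I, 0], !![1, 0; 0, -1]]

/-- The `n`-qubit Pauli string `P_σ`, the Kronecker product of the matrices `pauliMat (σ i)`. -/
noncomputable def pauliString {n : ℕ} (σ : Fin n → Fin 4) :
    Matrix (Fin n → Fin 2) (Fin n → Fin 2) ℂ :=
  Matrix.of fun x y => ∏ i, pauliMat (σ i) (x i) (y i)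

/-- A signed `n`-qubit Pauli string: `ε • P_σ` with `ε ∈ {1, -1}`. -/
def IsSignedPauli {n : ℕ} (M : Matrix (Fin n → Fin 2) (Fin n → Fin 2) ℂ) : Prop :=
  ∃ (ε : ℂ) (σ : Fin n → Fin 4), (ε = 1 ∨ ε = -1) ∧ M = ε • pauliString σ

/-- The identification of `(a+b)`-qubit basis labels with pairs of `a`-qubit and `b`-qubit
basis labels. -/
def splitEquiv (a b : ℕ) : (Fin (a + b) → Fin 2) ≃ (Fin a → Fin 2) × (Fin b → Fin 2) :=
  (Equiv.arrowCongr finSumFinEquiv.symm (Equiv.refl (Fin 2))).trans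
    (Equiv.sumArrowEquivProdArrow (Fin a) (Fin b) (Fin 2))

/-- The Kronecker product of an `a`-qubit matrix with a `b`-qubit matrix, viewed as an
`(a+b)`-qubit matrix via `splitEquiv`. -/
noncomputable def kronAB {a b : ℕ} (t : Matrix (Fin a → Fin 2) (Fin a → Fin 2) ℂ)
    (u : Matrix (Fin b → Fin 2) (Fin b → Fin 2) ℂ) :
    Matrix (Fin (a + b) → Fin 2) (Fin (a + b) → Fin 2) ℂ :=
  Matrix.of fun x y =>
    t (splitEquiv a b x).1 (splitEquiv a b y).1 * u (splitEquiv a b x).2 (splitEquiv a b y).2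

/-- Partial trace over the first `a` qubits of an `(a+b)`-qubit matrix. -/
noncomputable def partialTraceA {a b : ℕ}
    (M : Matrix (Fin (a + b) → Fin 2) (Fin (a + b) → Fin 2) ℂ) :
    Matrix (Fin b → Fin 2) (Fin b → Fin 2) ℂ :=
  Matrix.of fun j j' => ∑ i : Fin a → Fin 2,
    M ((splitEquiv a b).symm (i, j)) ((splitEquiv a b).symm (i, j'))

open Matrix

lemma pauliMat_mul_self (p : Fin 4) : pauliMat p * pauliMat p = 1 := by
  fin_cases p <;> ext i j <;> fin_cases i <;> fin_cases j <;>
    simp [pauliMat, Matrix.mul_apply, Fin.sum_univ_two]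

lemma trace_pauliMat_mul_of_ne {p q : Fin 4} (h : p ≠ q) :
    (pauliMat p * pauliMat q).trace = 0 := by
  fin_cases p <;> fin_cases q <;>
    simp [pauliMat, Matrix.trace, Fin.sum_univ_two] at h ⊢

lemma pauliString_mul_apply {n : ℕ} (σ τ : Fin n → Fin 4) (x z : Fin n → Fin 2) :
    (pauliString σ * pauliString τ) x z =
      ∏ i, (pauliMat (σ i) * pauliMat (τ i)) (x i) (z i) := by
  simp only [pauliString, Matrix.mul_apply, Matrix.of_apply, ← Finset.prod_mul_distrib]
  rw [Finset.prod_univ_sum, Fintype.piFinset_univ]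

lemma pauliString_mul_self {n : ℕ} (σ : Fin n → Fin 4) : pauliString σ * pauliString σ = 1 := by
  ext x z
  simp only [pauliString_mul_apply, pauliMat_mul_self, Matrix.one_apply,
    Finset.prod_ite_zero, Finset.prod_const_one, Finset.mem_univ, true_implies, funext_iff]

lemma trace_pauliString_mul_of_ne {n : ℕ} {σ τ : Fin n → Fin 4} (h : σ ≠ τ) :
    (pauliString σ * pauliString τ).trace = 0 := by
  obtain ⟨i, hi⟩ := Function.ne_iff.1 h
  have : (pauliString σ * pauliString τ).trace =
      ∏ i, (pauliMat (σ i) * pauliMat (τ i)).trace := by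
    simp only [Matrix.trace, Matrix.diag_apply, pauliString_mul_apply]
    rw [Finset.prod_univ_sum, Fintype.piFinset_univ]
  rw [this]
  exact Finset.prod_eq_zero (Finset.mem_univ i) (trace_pauliMat_mul_of_ne hi)

lemma trace_one_qubits (n : ℕ) :
    (1 : Matrix (Fin n → Fin 2) (Fin n → Fin 2) ℂ).trace = 2 ^ n := by
  simp [Matrix.trace_one]

lemma pauliString_zero {n : ℕ} : pauliString (fun _ : Fin n => 0) = 1 := by
  ext x z
  simp [pauliString, pauliMat, Matrix.one_apply, Finset.prod_ite_zero, funext_iff]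

namespace IsSignedPauli

variable {n : ℕ} {A : Matrix (Fin n → Fin 2) (Fin n → Fin 2) ℂ}

lemma mul_self (h : IsSignedPauli A) : A * A = 1 := by
  obtain ⟨ε, σ, rfl | rfl, rfl⟩ := h <;> simp [pauliString_mul_self]

lemma ne_zero (h : IsSignedPauli A) : A ≠ 0 := by
  rintro rfl
  simpa using h.mul_self

lemma trace_eq_zero (h : IsSignedPauli A) (h1 : A ≠ 1) (h2 : A ≠ -1) : A.trace = 0 := by
  obtain ⟨ε, σ, hε, rfl⟩ := h
  have hσ : σ ≠ fun _ => 0 := by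
    rintro rfl
    rcases hε with rfl | rfl <;> simp [pauliString_zero] at h1 h2
  have := trace_pauliString_mul_of_ne hσ
  rw [pauliString_zero, mul_one] at this
  simp [this]

end IsSignedPauli

/-- A finite set of signed Pauli strings that is a group under multiplication and does not
contain `-1`. It is automatically abelian. -/
structure IsStabilizer {n : ℕ} (U : Finset (Matrix (Fin n → Fin 2) (Fin n → Fin 2) ℂ)) :
    Prop where
  isSignedPauli : ∀ u ∈ U, IsSignedPauli u
  one_mem : 1 ∈ U
  mul_mem : ∀ u ∈ U, ∀ v ∈ U, u * v ∈ U
  neg_one_notMem : -1 ∉ U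

section Translation

variable {n : ℕ} {U : Finset (Matrix (Fin n → Fin 2) (Fin n → Fin 2) ℂ)}

lemma sum_mul_left_eq {β : Type*} [AddCommMonoid β] (hp : ∀ u ∈ U, IsSignedPauli u)
    (hm : ∀ u ∈ U, ∀ v ∈ U, u * v ∈ U) {u} (hu : u ∈ U)
    (f : Matrix (Fin n → Fin 2) (Fin n → Fin 2) ℂ → β) :
    ∑ v ∈ U, f (u * v) = ∑ v ∈ U, f v := by
  have h : ∀ v, u * (u * v) = v := fun v => by rw [← mul_assoc, (hp u hu).mul_self, one_mul]
  exact Finset.sum_nbij' (u * ·) (u * ·) (hm u hu) (hm u hu) (fun v _ => h v) (fun v _ => h v)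
    (fun _ _ => rfl)

lemma commute_of_mul_mem (hp : ∀ u ∈ U, IsSignedPauli u)
    (hm : ∀ u ∈ U, ∀ v ∈ U, u * v ∈ U) {u v} (hu : u ∈ U) (hv : v ∈ U) : u * v = v * u := by
  have h := (hp _ (hm u hu v hv)).mul_self
  calc u * v = u * (u * v * (u * v)) * v := by rw [h, mul_one]
    _ = (u * u) * (v * u) * (v * v) := by simp only [mul_assoc]
    _ = v * u := by rw [(hp u hu).mul_self, (hp v hv).mul_self, one_mul, mul_one]

lemma mul_sum_eq (hp : ∀ u ∈ U, IsSignedPauli u)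
    (hm : ∀ u ∈ U, ∀ v ∈ U, u * v ∈ U) {u} (hu : u ∈ U) : u * ∑ v ∈ U, v = ∑ v ∈ U, v := by
  rw [Finset.mul_sum]
  exact sum_mul_left_eq hp hm hu id

lemma sum_mul_eq (hp : ∀ u ∈ U, IsSignedPauli u)
    (hm : ∀ u ∈ U, ∀ v ∈ U, u * v ∈ U) {u} (hu : u ∈ U) :
    (∑ v ∈ U, v) * u = ∑ v ∈ U, v := by
  rw [Finset.sum_mul, Finset.sum_congr rfl fun v hv => commute_of_mul_mem hp hm hv hu,
    ← Finset.mul_sum, mul_sum_eq hp hm hu]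

lemma sum_mul_sum_eq (hp : ∀ u ∈ U, IsSignedPauli u) (hm : ∀ u ∈ U, ∀ v ∈ U, u * v ∈ U) :
    (∑ v ∈ U, v) * ∑ v ∈ U, v = (U.card : ℂ) • ∑ v ∈ U, v := by
  rw [Finset.sum_mul, Finset.sum_congr rfl fun v hv => mul_sum_eq hp hm hv, Finset.sum_const,
    Nat.cast_smul_eq_nsmul]

lemma IsStabilizer.trace_sum (h : IsStabilizer U) : (∑ u ∈ U, u).trace = 2 ^ n := by
  rw [Matrix.trace_sum, Finset.sum_eq_single_of_mem 1 h.one_mem, trace_one_qubits]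
  intro u hu h1
  exact (h.isSignedPauli u hu).trace_eq_zero h1 fun h2 => h.neg_one_notMem (h2 ▸ hu)

end Translation

lemma Matrix.exists_eq_vecMulVec_of_isIdempotentElem {K m : Type*} [Field K] [CharZero K]
    [Fintype m] [DecidableEq m] {P : Matrix m m K} (hP : P * P = P) (htr : P.trace = 1) :
    ∃ v w, P = vecMulVec v w := by
  have hid : IsIdempotentElem P.toLin' := by
    rw [IsIdempotentElem, Module.End.mul_eq_comp, ← Matrix.toLin'_mul, hP]
  have hrank := (LinearMap.isProj_range_iff_isIdempotentElem _).2 hid |>.trace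
  rw [Matrix.trace_toLin'_eq, htr] at hrank
  obtain ⟨v, -, hv⟩ := finrank_eq_one_iff'.1 (Nat.cast_eq_one.1 hrank.symm)
  choose c hc using fun j => hv ⟨P.toLin' (Pi.single j 1), LinearMap.mem_range_self _ _⟩
  refine ⟨v, c, ?_⟩
  ext i j
  have := congrFun (congrArg Subtype.val (hc j)) i
  simp at this
  rw [vecMulVec_apply, mul_comm, this]

lemma IsStabilizer.exists_sum_eq_vecMulVec {n : ℕ}
    {U : Finset (Matrix (Fin n → Fin 2) (Fin n → Fin 2) ℂ)} (h : IsStabilizer U)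
    (hcard : U.card = 2 ^ n) : ∃ v w, ∑ u ∈ U, u = vecMulVec v w := by
  have h2 : (2 : ℂ) ^ n ≠ 0 := by simp
  have hsq := sum_mul_sum_eq h.isSignedPauli h.mul_mem
  rw [hcard, Nat.cast_pow, Nat.cast_ofNat] at hsq
  obtain ⟨v, w, hvw⟩ := Matrix.exists_eq_vecMulVec_of_isIdempotentElem
    (P := ((2 : ℂ) ^ n)⁻¹ • ∑ u ∈ U, u)
    (by rw [smul_mul_smul_comm, hsq, smul_smul, mul_assoc, inv_mul_cancel₀ h2, mul_one])
    (by rw [Matrix.trace_smul, h.trace_sum, smul_eq_mul, inv_mul_cancel₀ h2])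
  exact ⟨(2 : ℂ) ^ n • v, w, by rw [smul_vecMulVec, ← hvw, smul_inv_smul₀ h2]⟩

section Kronecker

variable {a b : ℕ}

lemma sum_splitEquiv {β : Type*} [AddCommMonoid β] (f : (Fin (a + b) → Fin 2) → β) :
    ∑ x, f x = ∑ i, ∑ j, f ((splitEquiv a b).symm (i, j)) := by
  rw [← Equiv.sum_comp (splitEquiv a b).symm, Fintype.sum_prod_type]

lemma kronAB_apply_symm (t : Matrix (Fin a → Fin 2) (Fin a → Fin 2) ℂ)
    (u : Matrix (Fin b → Fin 2) (Fin b → Fin 2) ℂ) (i i' : Fin a → Fin 2) (j j' : Fin b → Fin 2) :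
    kronAB t u ((splitEquiv a b).symm (i, j)) ((splitEquiv a b).symm (i', j')) =
      t i i' * u j j' := by
  simp [kronAB]

lemma kronAB_mul (t t' : Matrix (Fin a → Fin 2) (Fin a → Fin 2) ℂ)
    (u u' : Matrix (Fin b → Fin 2) (Fin b → Fin 2) ℂ) :
    kronAB t u * kronAB t' u' = kronAB (t * t') (u * u') := by
  have h : ∀ (t : Matrix (Fin a → Fin 2) (Fin a → Fin 2) ℂ)
      (u : Matrix (Fin b → Fin 2) (Fin b → Fin 2) ℂ),
      kronAB t u = (kroneckerMap (· * ·) t u).submatrix (splitEquiv a b) (splitEquiv a b) :=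
    fun _ _ => rfl
  rw [h, h, h, Matrix.submatrix_mul_equiv, ← Matrix.mul_kronecker_mul]

lemma kronAB_smul_smul (x y : ℂ) (t : Matrix (Fin a → Fin 2) (Fin a → Fin 2) ℂ)
    (u : Matrix (Fin b → Fin 2) (Fin b → Fin 2) ℂ) :
    kronAB (x • t) (y • u) = (x * y) • kronAB t u := by
  ext i j
  simp [kronAB, mul_mul_mul_comm]

lemma kronAB_one_one :
    kronAB (1 : Matrix (Fin a → Fin 2) (Fin a → Fin 2) ℂ)
      (1 : Matrix (Fin b → Fin 2) (Fin b → Fin 2) ℂ) = 1 := by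
  have h : kronAB (1 : Matrix (Fin a → Fin 2) (Fin a → Fin 2) ℂ)
      (1 : Matrix (Fin b → Fin 2) (Fin b → Fin 2) ℂ) =
      (kroneckerMap (· * ·) 1 1).submatrix (splitEquiv a b) (splitEquiv a b) := rfl
  rw [h, Matrix.one_kronecker_one, Matrix.submatrix_one_equiv]

lemma kronAB_pauliString (σ : Fin a → Fin 4) (τ : Fin b → Fin 4) :
    kronAB (pauliString σ) (pauliString τ) = pauliString (Fin.append σ τ) := by
  ext x y
  simp [kronAB, pauliString, Fin.prod_univ_add, splitEquiv, Equiv.sumArrowEquivProdArrow,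
    Equiv.arrowCongr]

lemma partialTraceA_kronAB (t : Matrix (Fin a → Fin 2) (Fin a → Fin 2) ℂ)
    (u : Matrix (Fin b → Fin 2) (Fin b → Fin 2) ℂ) :
    partialTraceA (kronAB t u) = t.trace • u := by
  ext i j
  simp [partialTraceA, kronAB, Matrix.trace, Finset.sum_mul]

lemma partialTraceA_kronAB_one_mul (u : Matrix (Fin b → Fin 2) (Fin b → Fin 2) ℂ)
    (X : Matrix (Fin (a + b) → Fin 2) (Fin (a + b) → Fin 2) ℂ) :
    partialTraceA (kronAB 1 u * X) = u * partialTraceA X := by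
  ext j j'
  simp only [partialTraceA, Matrix.mul_apply, Matrix.of_apply, Finset.mul_sum]
  rw [Finset.sum_comm (s := Finset.univ (α := Fin b → Fin 2))]
  refine Finset.sum_congr rfl fun i _ => ?_
  rw [sum_splitEquiv, Finset.sum_eq_single i]
  · simp [kronAB_apply_symm]
  · intro i' _ hi'
    simp [kronAB_apply_symm, Matrix.one_apply_ne' hi']
  · simp

lemma partialTraceA_smul (c : ℂ)
    (M : Matrix (Fin (a + b) → Fin 2) (Fin (a + b) → Fin 2) ℂ) :
    partialTraceA (c • M) = c • partialTraceA M := by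
  ext i j
  simp [partialTraceA, Finset.mul_sum]

lemma partialTraceA_sum {ι : Type*} (s : Finset ι)
    (M : ι → Matrix (Fin (a + b) → Fin 2) (Fin (a + b) → Fin 2) ℂ) :
    partialTraceA (∑ i ∈ s, M i) = ∑ i ∈ s, partialTraceA (M i) := by
  ext i j
  simp only [partialTraceA, Matrix.sum_apply, Matrix.of_apply]
  exact Finset.sum_comm

lemma kronAB_sum_left {ι : Type*} (s : Finset ι)
    (t : ι → Matrix (Fin a → Fin 2) (Fin a → Fin 2) ℂ)
    (u : Matrix (Fin b → Fin 2) (Fin b → Fin 2) ℂ) :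
    kronAB (∑ i ∈ s, t i) u = ∑ i ∈ s, kronAB (t i) u := by
  ext i j
  simp [kronAB, Matrix.sum_apply, Finset.sum_mul]

/-- The contraction of an `a`-qubit matrix with the first `a` qubits of an `(a+b)`-qubit
matrix. -/
noncomputable def contractA (t : Matrix (Fin a → Fin 2) (Fin a → Fin 2) ℂ)
    (s : Matrix (Fin (a + b) → Fin 2) (Fin (a + b) → Fin 2) ℂ) :
    Matrix (Fin b → Fin 2) (Fin b → Fin 2) ℂ :=
  partialTraceA (kronAB t 1 * s)

lemma contractA_smul_smul (x y : ℂ) (t : Matrix (Fin a → Fin 2) (Fin a → Fin 2) ℂ)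
    (s : Matrix (Fin (a + b) → Fin 2) (Fin (a + b) → Fin 2) ℂ) :
    contractA (x • t) (y • s) = (x * y) • contractA t s := by
  rw [contractA, ← one_smul ℂ (1 : Matrix (Fin b → Fin 2) (Fin b → Fin 2) ℂ), kronAB_smul_smul,
    smul_mul_smul_comm, partialTraceA_smul, mul_one, contractA]

lemma contractA_sum_sum {ι κ : Type*} (I : Finset ι) (J : Finset κ)
    (t : ι → Matrix (Fin a → Fin 2) (Fin a → Fin 2) ℂ)
    (s : κ → Matrix (Fin (a + b) → Fin 2) (Fin (a + b) → Fin 2) ℂ) :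
    contractA (∑ i ∈ I, t i) (∑ j ∈ J, s j) = ∑ p ∈ I ×ˢ J, contractA (t p.1) (s p.2) := by
  rw [contractA, kronAB_sum_left, Finset.sum_mul_sum, partialTraceA_sum, Finset.sum_product]
  exact Finset.sum_congr rfl fun i _ => partialTraceA_sum _ _

lemma contractA_kronAB (t t' : Matrix (Fin a → Fin 2) (Fin a → Fin 2) ℂ)
    (u : Matrix (Fin b → Fin 2) (Fin b → Fin 2) ℂ) :
    contractA t (kronAB t' u) = (t * t').trace • u := by
  rw [contractA, kronAB_mul, one_mul, partialTraceA_kronAB]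

lemma contractA_vecMulVec (p q : (Fin a → Fin 2) → ℂ) (v w : (Fin (a + b) → Fin 2) → ℂ) :
    ∃ x y, contractA (vecMulVec p q) (vecMulVec v w) = vecMulVec x y := by
  refine ⟨fun j => ∑ i, q i * v ((splitEquiv a b).symm (i, j)),
    fun j => ∑ i, p i * w ((splitEquiv a b).symm (i, j)), ?_⟩
  ext j j'
  simp only [contractA, partialTraceA, Matrix.of_apply, Matrix.mul_apply, vecMulVec_apply]
  simp_rw [sum_splitEquiv (a := a) (b := b), kronAB_apply_symm, vecMulVec_apply,
    Matrix.one_apply, mul_ite, ite_mul, mul_one, mul_zero, zero_mul, Finset.sum_ite_eq,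
    Finset.mem_univ, if_true]
  rw [mul_comm, Finset.sum_mul_sum]
  exact Finset.sum_congr rfl fun i _ => Finset.sum_congr rfl fun i' _ => by ring

lemma contractA_eq_zero_or {t : Matrix (Fin a → Fin 2) (Fin a → Fin 2) ℂ}
    {s : Matrix (Fin (a + b) → Fin 2) (Fin (a + b) → Fin 2) ℂ}
    (ht : IsSignedPauli t) (hs : IsSignedPauli s) :
    contractA t s = 0 ∨ ∃ u, IsSignedPauli u ∧ s = kronAB t u := by
  obtain ⟨ε, τ, hε, rfl⟩ := ht
  obtain ⟨δ, ρ, hδ, rfl⟩ := hs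
  obtain ⟨σ, ρ, rfl⟩ : ∃ σ ρ', ρ = Fin.append σ ρ' := ⟨_, _, (Fin.append_castAdd_natAdd).symm⟩
  rw [← kronAB_pauliString]
  by_cases h : τ = σ
  · subst h
    refine Or.inr ⟨(ε * δ) • pauliString ρ, ⟨_, _, ?_, rfl⟩, ?_⟩
    · rcases hε with rfl | rfl <;> rcases hδ with rfl | rfl <;> simp
    · rw [kronAB_smul_smul]
      rcases hε with rfl | rfl <;> simp
  · left
    rw [contractA_smul_smul, contractA_kronAB, trace_pauliString_mul_of_ne h, zero_smul, smul_zero]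

lemma contractA_self_kronAB {t : Matrix (Fin a → Fin 2) (Fin a → Fin 2) ℂ}
    (ht : IsSignedPauli t) (u : Matrix (Fin b → Fin 2) (Fin b → Fin 2) ℂ) :
    contractA t (kronAB t u) = (2 : ℂ) ^ a • u := by
  rw [contractA_kronAB, ht.mul_self, trace_one_qubits]

end Kronecker

/-- The signed Pauli strings `u` such that `t ⊗ u ∈ S` for some `t ∈ T`. -/
noncomputable def contractGroup {a b : ℕ}
    (T : Finset (Matrix (Fin a → Fin 2) (Fin a → Fin 2) ℂ))
    (S : Finset (Matrix (Fin (a + b) → Fin 2) (Fin (a + b) → Fin 2) ℂ)) :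
    Finset (Matrix (Fin b → Fin 2) (Fin b → Fin 2) ℂ) :=
  open Classical in
  ((T ×ˢ S).image fun p => ((2 : ℂ) ^ a)⁻¹ • contractA p.1 p.2).filter IsSignedPauli

section ContractGroup

variable {a b : ℕ} {T : Finset (Matrix (Fin a → Fin 2) (Fin a → Fin 2) ℂ)}
  {S : Finset (Matrix (Fin (a + b) → Fin 2) (Fin (a + b) → Fin 2) ℂ)}
  {u : Matrix (Fin b → Fin 2) (Fin b → Fin 2) ℂ}

lemma mem_contractGroup_iff (hT : ∀ t ∈ T, IsSignedPauli t) (hS : ∀ s ∈ S, IsSignedPauli s) :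
    u ∈ contractGroup T S ↔ IsSignedPauli u ∧ ∃ t ∈ T, kronAB t u ∈ S := by
  have h2 : (2 : ℂ) ^ a ≠ 0 := by simp
  simp only [contractGroup, Finset.mem_filter, Finset.mem_image, Finset.mem_product, Prod.exists]
  constructor
  · rintro ⟨⟨t, s, ⟨ht, hs⟩, rfl⟩, hu⟩
    refine ⟨hu, t, ht, ?_⟩
    rcases contractA_eq_zero_or (hT t ht) (hS s hs) with h0 | ⟨v, -, rfl⟩
    · exact absurd (by rw [h0, smul_zero]) hu.ne_zero
    · rwa [contractA_self_kronAB (hT t ht), inv_smul_smul₀ h2]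
  · rintro ⟨hu, t, ht, hs⟩
    exact ⟨⟨t, _, ⟨ht, hs⟩, by rw [contractA_self_kronAB (hT t ht), inv_smul_smul₀ h2]⟩, hu⟩

lemma contractGroup_mul_mem (hT : IsStabilizer T) (hS : IsStabilizer S)
    {v : Matrix (Fin b → Fin 2) (Fin b → Fin 2) ℂ}
    (hu : u ∈ contractGroup T S) (hv : v ∈ contractGroup T S) :
    u * v ∈ contractGroup T S := by
  rw [mem_contractGroup_iff hT.isSignedPauli hS.isSignedPauli] at hu hv ⊢
  obtain ⟨hu, t, ht, hs⟩ := hu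
  obtain ⟨hv, t', ht', hs'⟩ := hv
  have h2 : (2 : ℂ) ^ a ≠ 0 := by simp
  have htt := hT.mul_mem t ht t' ht'
  have hss := hS.mul_mem _ hs _ hs'
  rw [kronAB_mul] at hss
  refine ⟨?_, _, htt, hss⟩
  have hc := contractA_self_kronAB (hT.isSignedPauli _ htt) (u * v)
  rcases contractA_eq_zero_or (hT.isSignedPauli _ htt) (hS.isSignedPauli _ hss) with
    h0 | ⟨w, hw, hw'⟩
  · rw [h0] at hc
    have huv : u * v = 0 := (smul_eq_zero.1 hc.symm).resolve_left h2
    have hv0 : v = 0 := by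
      rw [← one_mul v, ← hu.mul_self, mul_assoc, huv, mul_zero]
    exact absurd hv0 hv.ne_zero
  · rw [hw', contractA_self_kronAB (hT.isSignedPauli _ htt)] at hc
    rwa [← smul_right_injective _ h2 hc]

lemma contractA_translate {t t' : Matrix (Fin a → Fin 2) (Fin a → Fin 2) ℂ}
    {s : Matrix (Fin (a + b) → Fin 2) (Fin (a + b) → Fin 2) ℂ}
    (ht : IsSignedPauli t) (hcomm : t * t' = t' * t) :
    contractA (t * t') (kronAB t u * s) = u * contractA t' s := by
  have h1 : kronAB (t * t') 1 * (kronAB t u * s) = kronAB 1 u * (kronAB t' 1 * s) := by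
    rw [← mul_assoc, ← mul_assoc, kronAB_mul, kronAB_mul, hcomm, mul_assoc t', ht.mul_self,
      mul_one, one_mul, one_mul, mul_one]
  rw [contractA, h1, partialTraceA_kronAB_one_mul, contractA]

lemma mul_contractA_sum (hT : IsStabilizer T) (hS : IsStabilizer S)
    (hu : u ∈ contractGroup T S) :
    u * contractA (∑ t ∈ T, t) (∑ s ∈ S, s) = contractA (∑ t ∈ T, t) (∑ s ∈ S, s) := by
  obtain ⟨-, t, ht, hs⟩ := (mem_contractGroup_iff hT.isSignedPauli hS.isSignedPauli).1 hu
  rw [contractA_sum_sum, Finset.mul_sum, Finset.sum_product, Finset.sum_product]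
  refine Eq.trans ?_ (sum_mul_left_eq hT.isSignedPauli hT.mul_mem ht
    fun t' => ∑ s ∈ S, contractA t' s)
  refine Finset.sum_congr rfl fun t' ht' => ?_
  refine Eq.trans ?_ (sum_mul_left_eq hS.isSignedPauli hS.mul_mem hs (contractA (t * t')))
  exact Finset.sum_congr rfl fun s _ => (contractA_translate (hT.isSignedPauli t ht)
    (commute_of_mul_mem hT.isSignedPauli hT.mul_mem ht ht')).symm

lemma sum_mul_contractA (hT : IsStabilizer T) (hS : IsStabilizer S) :
    ∃ N : ℕ, (∑ u ∈ contractGroup T S, u) * contractA (∑ t ∈ T, t) (∑ s ∈ S, s) =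
      (2 ^ a * N : ℂ) • ∑ u ∈ contractGroup T S, u := by
  classical
  refine ⟨((T ×ˢ S).filter fun p => contractA p.1 p.2 ≠ 0).card, ?_⟩
  rw [contractA_sum_sum, Finset.mul_sum, ← Finset.sum_filter_add_sum_filter_not _
    (fun p => contractA p.1 p.2 ≠ 0)]
  rw [Finset.sum_congr rfl (g := fun _ => (2 : ℂ) ^ a • ∑ u ∈ contractGroup T S, u),
    Finset.sum_eq_zero (s := Finset.filter (fun p => ¬ contractA p.1 p.2 ≠ 0) (T ×ˢ S)),
    Finset.sum_const, add_zero, mul_comm, ← smul_smul, Nat.cast_smul_eq_nsmul]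
  · intro p hp
    rw [not_not.1 (Finset.mem_filter.1 hp).2, mul_zero]
  · rintro ⟨t, s⟩ hp
    obtain ⟨hp, h0⟩ := Finset.mem_filter.1 hp
    obtain ⟨ht, hs⟩ := Finset.mem_product.1 hp
    obtain ⟨u, hu, rfl⟩ := (contractA_eq_zero_or (hT.isSignedPauli t ht)
      (hS.isSignedPauli s hs)).resolve_left h0
    have hmem : u ∈ contractGroup T S :=
      (mem_contractGroup_iff hT.isSignedPauli hS.isSignedPauli).2 ⟨hu, t, ht, hs⟩
    rw [contractA_self_kronAB (hT.isSignedPauli t ht), mul_smul_comm,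
      sum_mul_eq (fun u hu => ((mem_contractGroup_iff hT.isSignedPauli hS.isSignedPauli).1 hu).1)
        (fun _ hu _ hv => contractGroup_mul_mem hT hS hu hv) hmem]

/-- The contraction of two unnormalised stabilizer-state projectors is a natural multiple of
the sum over `contractGroup`, up to the cardinality of that group. -/
lemma card_smul_contractA (hT : IsStabilizer T) (hS : IsStabilizer S) :
    ∃ N : ℕ, ((contractGroup T S).card : ℂ) • contractA (∑ t ∈ T, t) (∑ s ∈ S, s) =
      (2 ^ a * N : ℂ) • ∑ u ∈ contractGroup T S, u := by
  obtain ⟨N, hN⟩ := sum_mul_contractA hT hS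
  refine ⟨N, ?_⟩
  rw [← hN, Finset.sum_mul, Finset.sum_congr rfl fun u hu => mul_contractA_sum hT hS hu,
    Finset.sum_const, Nat.cast_smul_eq_nsmul]

lemma isStabilizer_contractGroup (hT : IsStabilizer T) (hS : IsStabilizer S)
    (h0 : contractA (∑ t ∈ T, t) (∑ s ∈ S, s) ≠ 0) : IsStabilizer (contractGroup T S) where
  isSignedPauli u hu := ((mem_contractGroup_iff hT.isSignedPauli hS.isSignedPauli).1 hu).1
  one_mem := (mem_contractGroup_iff hT.isSignedPauli hS.isSignedPauli).2
    ⟨⟨1, _, Or.inl rfl, by rw [pauliString_zero, one_smul]⟩, 1, hT.one_mem,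
      kronAB_one_one ▸ hS.one_mem⟩
  mul_mem _ hu _ hv := contractGroup_mul_mem hT hS hu hv
  neg_one_notMem h := by
    have h1 := mul_contractA_sum hT hS h
    rw [neg_one_mul] at h1
    refine h0 (Matrix.ext fun i j => ?_)
    exact self_eq_neg.1 (congrFun (congrFun h1 i) j).symm

lemma card_eq_of_smul_sum_eq_vecMulVec {n : ℕ}
    {U : Finset (Matrix (Fin n → Fin 2) (Fin n → Fin 2) ℂ)} (hU : IsStabilizer U) {c : ℂ}
    (hc : c ≠ 0) {x y : (Fin n → Fin 2) → ℂ} (h : c • ∑ u ∈ U, u = vecMulVec x y) :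
    U.card = 2 ^ n := by
  have hE : ∑ u ∈ U, u ≠ 0 := by
    intro h0
    have := hU.trace_sum
    rw [h0, Matrix.trace_zero] at this
    exact pow_ne_zero n two_ne_zero this.symm
  have hsq : vecMulVec x y * vecMulVec x y = (vecMulVec x y).trace • vecMulVec x y := by
    rw [vecMulVec_mul_vecMulVec, Matrix.trace_vecMulVec, vecMulVec_smul, dotProduct_comm]
  rw [← h, smul_mul_smul_comm, sum_mul_sum_eq hU.isSignedPauli hU.mul_mem, Matrix.trace_smul,
    hU.trace_sum, smul_smul, smul_smul, smul_eq_mul] at hsq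
  have := smul_left_injective ℂ hE hsq
  have h3 : (U.card : ℂ) = 2 ^ n := mul_left_cancel₀ (mul_ne_zero hc hc) (by linear_combination this)
  exact_mod_cast h3

end ContractGroup

/-- The matrices of the elements of a finite subgroup of the general linear group. -/
noncomputable def subgroupMatrices {n : ℕ}
    (S : Subgroup (Matrix.GeneralLinearGroup (Fin n → Fin 2) ℂ)) [Fintype S] :
    Finset (Matrix (Fin n → Fin 2) (Fin n → Fin 2) ℂ) :=
  Finset.univ.map ⟨fun s : S => ((s : Matrix.GeneralLinearGroup (Fin n → Fin 2) ℂ) :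
    Matrix (Fin n → Fin 2) (Fin n → Fin 2) ℂ), Units.val_injective.comp Subtype.val_injective⟩

lemma isStabilizer_subgroupMatrices {n : ℕ}
    (S : Subgroup (Matrix.GeneralLinearGroup (Fin n → Fin 2) ℂ)) [Fintype S]
    (hpauli : ∀ s ∈ S, IsSignedPauli (s : Matrix (Fin n → Fin 2) (Fin n → Fin 2) ℂ))
    (hneg : (-1 : Matrix.GeneralLinearGroup (Fin n → Fin 2) ℂ) ∉ S) :
    IsStabilizer (subgroupMatrices S) := by
  have hmem : ∀ A, A ∈ subgroupMatrices S ↔ ∃ s ∈ S, s.val = A := by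
    simp [subgroupMatrices]
  refine ⟨?_, ?_, ?_, ?_⟩ <;> simp only [hmem]
  · rintro _ ⟨s, hs, rfl⟩
    exact hpauli s hs
  · exact ⟨1, S.one_mem, rfl⟩
  · rintro _ ⟨s, hs, rfl⟩ _ ⟨t, ht, rfl⟩
    exact ⟨s * t, S.mul_mem hs ht, rfl⟩
  · rintro ⟨s, hs, h⟩
    exact hneg ((Units.ext h : s = -1) ▸ hs)

/-- the contraction of a full-rank stabilizer-state projector `Π_S` on `a+b`
qubits with a full-rank stabilizer-state projector `Π_T` on the first `a` qubits is, when
nonzero, a positive multiple of a full-rank stabilizer-state projector on the remaining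
`b` qubits. -/
theorem contraction_of_stabilizer_states {a b : ℕ} (ha : 1 ≤ a) (hb : 1 ≤ b)
    (S : Subgroup (Matrix.GeneralLinearGroup (Fin (a + b) → Fin 2) ℂ)) [Fintype S]
    (T : Subgroup (Matrix.GeneralLinearGroup (Fin a → Fin 2) ℂ)) [Fintype T]
    (hSpauli : ∀ s ∈ S,
      IsSignedPauli (s : Matrix (Fin (a + b) → Fin 2) (Fin (a + b) → Fin 2) ℂ))
    (hSab : ∀ s ∈ S, ∀ s' ∈ S, s * s' = s' * s)
    (hScard : Nat.card S = 2 ^ (a + b))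
    (hSneg : (-1 : Matrix.GeneralLinearGroup (Fin (a + b) → Fin 2) ℂ) ∉ S)
    (hTpauli : ∀ t ∈ T, IsSignedPauli (t : Matrix (Fin a → Fin 2) (Fin a → Fin 2) ℂ))
    (hTab : ∀ t ∈ T, ∀ t' ∈ T, t * t' = t' * t)
    (hTcard : Nat.card T = 2 ^ a)
    (hTneg : (-1 : Matrix.GeneralLinearGroup (Fin a → Fin 2) ℂ) ∉ T) :
    let PiS : Matrix (Fin (a + b) → Fin 2) (Fin (a + b) → Fin 2) ℂ :=
      ((2 : ℂ) ^ (a + b))⁻¹ • ∑ s : S,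
        ((s : Matrix.GeneralLinearGroup (Fin (a + b) → Fin 2) ℂ) :
          Matrix (Fin (a + b) → Fin 2) (Fin (a + b) → Fin 2) ℂ)
    let PiT : Matrix (Fin a → Fin 2) (Fin a → Fin 2) ℂ :=
      ((2 : ℂ) ^ a)⁻¹ • ∑ t : T,
        ((t : Matrix.GeneralLinearGroup (Fin a → Fin 2) ℂ) :
          Matrix (Fin a → Fin 2) (Fin a → Fin 2) ℂ)
    let M : Matrix (Fin b → Fin 2) (Fin b → Fin 2) ℂ :=
      partialTraceA (kronAB PiT (1 : Matrix (Fin b → Fin 2) (Fin b → Fin 2) ℂ) * PiS)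
    M ≠ 0 →
      ∃ (U : Finset (Matrix (Fin b → Fin 2) (Fin b → Fin 2) ℂ)) (c : ℝ),
        (∀ u ∈ U, IsSignedPauli u) ∧
        (1 : Matrix (Fin b → Fin 2) (Fin b → Fin 2) ℂ) ∈ U ∧
        (∀ u ∈ U, ∀ v ∈ U, u * v ∈ U) ∧
        (∀ u ∈ U, ∀ v ∈ U, u * v = v * u) ∧
        U.card = 2 ^ b ∧
        (-1 : Matrix (Fin b → Fin 2) (Fin b → Fin 2) ℂ) ∉ U ∧
        0 < c ∧
        M = (c : ℂ) • ∑ u ∈ U, u := by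
  intro PiS PiT M hM
  have hS := isStabilizer_subgroupMatrices S hSpauli hSneg
  have hT := isStabilizer_subgroupMatrices T hTpauli hTneg
  have hSc : (subgroupMatrices S).card = 2 ^ (a + b) := by
    rw [subgroupMatrices, Finset.card_map, Finset.card_univ, ← Nat.card_eq_fintype_card, hScard]
  have hTc : (subgroupMatrices T).card = 2 ^ a := by
    rw [subgroupMatrices, Finset.card_map, Finset.card_univ, ← Nat.card_eq_fintype_card, hTcard]
  have hMeq : M = (((2 : ℂ) ^ a)⁻¹ * ((2 : ℂ) ^ (a + b))⁻¹) •
      contractA (∑ t ∈ subgroupMatrices T, t) (∑ s ∈ subgroupMatrices S, s) := by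
    rw [← contractA_smul_smul, subgroupMatrices, subgroupMatrices, Finset.sum_map,
      Finset.sum_map]
    rfl
  have h0 : contractA (∑ t ∈ subgroupMatrices T, t) (∑ s ∈ subgroupMatrices S, s) ≠ 0 := by
    intro h
    rw [h, smul_zero] at hMeq
    exact hM hMeq
  have hU := isStabilizer_contractGroup hT hS h0
  obtain ⟨N, hN⟩ := card_smul_contractA hT hS
  set U := contractGroup (subgroupMatrices T) (subgroupMatrices S)
  have hUpos : 0 < U.card := Finset.card_pos.2 ⟨1, hU.one_mem⟩
  have hUne : (U.card : ℂ) ≠ 0 := Nat.cast_ne_zero.2 hUpos.ne'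
  have hNpos : 0 < N := by
    rw [Nat.pos_iff_ne_zero]
    rintro rfl
    rw [Nat.cast_zero, mul_zero, zero_smul] at hN
    exact h0 ((smul_eq_zero.1 hN).resolve_left hUne)
  have hC := (eq_inv_smul_iff₀ hUne).2 hN
  rw [smul_smul] at hC
  have hcard : U.card = 2 ^ b := by
    obtain ⟨v, w, hvw⟩ := hS.exists_sum_eq_vecMulVec hSc
    obtain ⟨p, q, hpq⟩ := hT.exists_sum_eq_vecMulVec hTc
    obtain ⟨x, y, hxy⟩ := contractA_vecMulVec p q v w
    rw [← hvw, ← hpq, hC] at hxy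
    refine card_eq_of_smul_sum_eq_vecMulVec hU ?_ hxy
    have : (N : ℂ) ≠ 0 := Nat.cast_ne_zero.2 hNpos.ne'
    simp [this, hUne]
  refine ⟨U, (2 ^ a)⁻¹ * (2 ^ (a + b))⁻¹ * ((U.card : ℝ)⁻¹ * (2 ^ a * N)),
    hU.isSignedPauli, hU.one_mem, hU.mul_mem,
    fun u hu v hv => commute_of_mul_mem hU.isSignedPauli hU.mul_mem hu hv, hcard,
    hU.neg_one_notMem, by positivity, ?_⟩
  rw [hMeq, hC, smul_smul]
  push_cast
  rfl
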